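/- Let K be an odd integer with K ≥ −1, set m := 2(K+3), and let n₁, n₂ be positive integers with n₁ < m odd and n₂ < m even. Then for every τ ∈ ℍ and all z, t ∈ ℂ: (i) G⁺_{n₁,n₂}(τ+1, z, t) = −(−1)^{(K+3)/2} · e^{πi(n₁²+n₂²)/(4(K+3))} · G⁻_{n₁,n₂}(τ, z, t); and (ii) G⁻_{n₁,n₂}(τ+1, z, t) = (−1)^{(K+3)/2} · e^{πi(n₁²+n₂²)/(4(K+3))} · G⁺_{n₁,n₂}(τ, z, t). -/

import Mathlib

noncomputable section

open Complex Real UpperHalfPlane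

/-- The Jacobi theta function
`θ_{j,m}(τ,z) := Σ_{n∈ℤ} e^{2πi m (n + j/(2m)) z} e^{2πi τ m (n + j/(2m))²}`. -/
def jacobiTh (m j : ℤ) (τ z : ℂ) : ℂ :=
  ∑' n : ℤ,
    Complex.exp (2 * (π : ℂ) * Complex.I * (m : ℂ) * ((n : ℂ) + (j : ℂ) / (2 * (m : ℂ))) * z) *
    Complex.exp (2 * (π : ℂ) * Complex.I * τ * (m : ℂ) * ((n : ℂ) + (j : ℂ) / (2 * (m : ℂ))) ^ 2)

/-- The Gauss sum `γ_m := Σ_{k=0}^{2m−1} e^{πi k²/m}`. -/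
def gammaGauss (m : ℤ) : ℂ :=
  ∑ k ∈ Finset.Icc (0 : ℤ) (2 * m - 1),
    Complex.exp ((π : ℂ) * Complex.I * (k : ℂ) ^ 2 / (m : ℂ))

/-- The Ramond-sector numerator of the character of the quantum Hamiltonian
reduction: with `m = 2(K+3)`,
`G⁺_{j₁,j₂}(τ,z,t) := e^{4πi(K+3)t} e^{πi(K+3)τ/2}
  (θ_{j₁,m} − θ_{−j₁,m})(τ, −z−τ/2) (θ_{j₂,m} − θ_{−j₂,m})(τ, z−τ/2)`. -/
def Gplus (K j₁ j₂ : ℤ) (τ z t : ℂ) : ℂ :=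
  Complex.exp (4 * (π : ℂ) * Complex.I * ((K : ℂ) + 3) * t) *
  Complex.exp ((π : ℂ) * Complex.I * ((K : ℂ) + 3) * τ / 2) *
  (jacobiTh (2 * (K + 3)) j₁ τ (-z - τ / 2) -
    jacobiTh (2 * (K + 3)) (-j₁) τ (-z - τ / 2)) *
  (jacobiTh (2 * (K + 3)) j₂ τ (z - τ / 2) -
    jacobiTh (2 * (K + 3)) (-j₂) τ (z - τ / 2))

/-- The Neveu–Schwarz-sector numerator of the character of the quantum
Hamiltonian reduction: with `m = 2(K+3)`,
`G⁻_{j₁,j₂}(τ,z,t) := e^{4πi(K+3)t} e^{πi(K+3)τ/2}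
  (θ_{j₁,m} − θ_{−j₁,m})(τ, −z+1/2−τ/2) (θ_{j₂,m} − θ_{−j₂,m})(τ, z+1/2−τ/2)`. -/
def Gminus (K j₁ j₂ : ℤ) (τ z t : ℂ) : ℂ :=
  Complex.exp (4 * (π : ℂ) * Complex.I * ((K : ℂ) + 3) * t) *
  Complex.exp ((π : ℂ) * Complex.I * ((K : ℂ) + 3) * τ / 2) *
  (jacobiTh (2 * (K + 3)) j₁ τ (-z + 1 / 2 - τ / 2) -
    jacobiTh (2 * (K + 3)) (-j₁) τ (-z + 1 / 2 - τ / 2)) *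
  (jacobiTh (2 * (K + 3)) j₂ τ (z + 1 / 2 - τ / 2) -
    jacobiTh (2 * (K + 3)) (-j₂) τ (z + 1 / 2 - τ / 2))

lemma jacobiTh_T (m j : ℤ) (hm : m ≠ 0) (τ z : ℂ) :
    jacobiTh m j (τ + 1) z =
      Complex.exp ((π : ℂ) * Complex.I * (j : ℂ) ^ 2 / (2 * (m : ℂ))) * jacobiTh m j τ z := by
  have hm' : (m : ℂ) ≠ 0 := by exact_mod_cast hm
  unfold jacobiTh
  rw [← tsum_mul_left]
  congr 1
  funext n
  rw [← Complex.exp_add, ← Complex.exp_add, ← Complex.exp_add, Complex.exp_eq_exp_iff_exists_int]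
  refine ⟨m * n ^ 2 + n * j, ?_⟩
  push_cast
  field_simp
  ring

lemma jacobiTh_shift (m j : ℤ) (hm : m ≠ 0) (τ z : ℂ) :
    jacobiTh m j τ (z - 1) =
      Complex.exp ((π : ℂ) * Complex.I * (j : ℂ)) * jacobiTh m j τ z := by
  have hm' : (m : ℂ) ≠ 0 := by exact_mod_cast hm
  unfold jacobiTh
  rw [← tsum_mul_left]
  congr 1
  funext n
  rw [← Complex.exp_add, ← Complex.exp_add, ← Complex.exp_add, Complex.exp_eq_exp_iff_exists_int]
  refine ⟨-(m * n) - j, ?_⟩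
  push_cast
  field_simp
  ring

lemma exp_pi_odd (j : ℤ) (h : Odd j) : Complex.exp ((π : ℂ) * Complex.I * (j : ℂ)) = -1 := by
  rw [← Complex.exp_pi_mul_I, Complex.exp_eq_exp_iff_exists_int]
  obtain ⟨k, rfl⟩ := h
  exact ⟨k, by push_cast; ring⟩

lemma exp_pi_even (j : ℤ) (h : Even j) : Complex.exp ((π : ℂ) * Complex.I * (j : ℂ)) = 1 := by
  rw [Complex.exp_eq_one_iff]
  obtain ⟨k, rfl⟩ := h
  exact ⟨k, by push_cast; ring⟩

lemma exp_pi_pow (j : ℤ) : Complex.exp ((π : ℂ) * Complex.I * (j : ℂ)) = (-1 : ℂ) ^ j := by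
  rw [← Complex.exp_pi_mul_I, ← Complex.exp_int_mul]
  congr 1
  ring

/-- `T`-transformation of the numerators of the quantum
Hamiltonian reduction, for odd `K ≥ −1`, `n₁` odd and `n₂` even with
`0 < n₁, n₂ < 2(K+3)`:
`G⁺_{n₁,n₂}(τ+1,z,t) = −(−1)^{(K+3)/2} e^{πi(n₁²+n₂²)/(4(K+3))} G⁻_{n₁,n₂}(τ,z,t)` and
`G⁻_{n₁,n₂}(τ+1,z,t) = (−1)^{(K+3)/2} e^{πi(n₁²+n₂²)/(4(K+3))} G⁺_{n₁,n₂}(τ,z,t)`. -/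
theorem statement18 (K : ℤ) (hK : -1 ≤ K) (hKodd : Odd K) (n₁ n₂ : ℤ)
    (hn₁ : 0 < n₁) (hn₂ : 0 < n₂)
    (hn₁' : n₁ < 2 * (K + 3)) (hn₂' : n₂ < 2 * (K + 3))
    (hn₁odd : Odd n₁) (hn₂even : Even n₂) (τ : ℍ) (z t : ℂ) :
    (Gplus K n₁ n₂ ((τ : ℂ) + 1) z t =
      -(-1 : ℂ) ^ ((K + 3) / 2) *
        Complex.exp ((π : ℂ) * Complex.I * ((n₁ : ℂ) ^ 2 + (n₂ : ℂ) ^ 2) /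
          (4 * ((K : ℂ) + 3))) *
        Gminus K n₁ n₂ (τ : ℂ) z t) ∧
    (Gminus K n₁ n₂ ((τ : ℂ) + 1) z t =
      (-1 : ℂ) ^ ((K + 3) / 2) *
        Complex.exp ((π : ℂ) * Complex.I * ((n₁ : ℂ) ^ 2 + (n₂ : ℂ) ^ 2) /
          (4 * ((K : ℂ) + 3))) *
        Gplus K n₁ n₂ (τ : ℂ) z t) := by
  have hm : 2 * (K + 3) ≠ 0 := by omega
  have hK3 : ((K : ℂ) + 3) ≠ 0 := by
    have : K + 3 ≠ 0 := by omega
    exact_mod_cast this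
  have e0 : Complex.exp ((π : ℂ) * Complex.I * ((K : ℂ) + 3) * ((τ : ℂ) + 1) / 2) =
      (-1 : ℂ) ^ ((K + 3) / 2) * Complex.exp ((π : ℂ) * Complex.I * ((K : ℂ) + 3) * (τ : ℂ) / 2) := by
    obtain ⟨k, rfl⟩ := hKodd
    have : (2 * k + 1 + 3) / 2 = k + 2 := by omega
    rw [this, ← exp_pi_pow, ← Complex.exp_add]
    congr 1
    push_cast
    ring
  have e1 : Complex.exp ((π : ℂ) * Complex.I * ((n₁ : ℂ) ^ 2 + (n₂ : ℂ) ^ 2) /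
          (4 * ((K : ℂ) + 3))) =
      Complex.exp ((π : ℂ) * Complex.I * (n₁ : ℂ) ^ 2 / (2 * ((2 * (K + 3) : ℤ) : ℂ))) *
      Complex.exp ((π : ℂ) * Complex.I * (n₂ : ℂ) ^ 2 / (2 * ((2 * (K + 3) : ℤ) : ℂ))) := by
    rw [← Complex.exp_add]
    congr 1
    push_cast
    field_simp
    ring
  have s : ∀ j : ℤ, (((-j : ℤ) : ℂ)) ^ 2 = (j : ℂ) ^ 2 := fun j => by push_cast; ring
  have a1 : -z - ((τ : ℂ) + 1) / 2 = (-z + 1 / 2 - (τ : ℂ) / 2) - 1 := by ring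
  have a2 : z - ((τ : ℂ) + 1) / 2 = (z + 1 / 2 - (τ : ℂ) / 2) - 1 := by ring
  have a3 : -z + 1 / 2 - ((τ : ℂ) + 1) / 2 = -z - (τ : ℂ) / 2 := by ring
  have a4 : z + 1 / 2 - ((τ : ℂ) + 1) / 2 = z - (τ : ℂ) / 2 := by ring
  unfold Gplus Gminus
  rw [e0, e1, a1, a2, a3, a4]
  simp only [jacobiTh_T _ _ hm, jacobiTh_shift _ _ hm, s, exp_pi_odd _ hn₁odd,
    exp_pi_odd _ hn₁odd.neg, exp_pi_even _ hn₂even, exp_pi_even _ hn₂even.neg]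
  constructor <;> ring

end
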